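/- arXiv:1110.5174 — 2 statements merged into one kernel-verified Lean document; each statement's English description precedes it below -/
import Mathlib

section
/- Let N ≥ 1 and let x : ℤ/Nℤ → ℂ be a function that is not identically zero. Then ‖x‖₀ + ‖x̂‖₀ ≥ 2√N. -/
/-- Discrete Fourier transform on `ℤ/Nℤ`:
`x̂(ω) = ∑_{t ∈ ℤ/Nℤ} x(t) · e^{-2πiωt/N}`. -/
noncomputable def dft {N : ℕ} [NeZero N] (x : ZMod N → ℂ) (ω : ZMod N) : ℂ :=
  ∑ t : ZMod N,
    x t * Complex.exp (-(2 * Real.pi * Complex.I * (ω.val * t.val)) / N)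

theorem dft_eq_zmod_dft {N : ℕ} [NeZero N] (x : ZMod N → ℂ) : dft x = ZMod.dft x := by
  funext ω
  rw [ZMod.dft_apply, dft]
  refine Finset.sum_congr rfl fun t _ => ?_
  have h : -(t * ω) = ((-((ω.val : ℤ) * t.val) : ℤ) : ZMod N) := by
    push_cast
    rw [ZMod.natCast_zmod_val, ZMod.natCast_zmod_val, mul_comm]
  rw [h, ZMod.stdAddChar_coe, smul_eq_mul, mul_comm]
  congr 2
  push_cast
  ring

theorem norm_zmod_dft_le_ncard_support_mul {N : ℕ} [NeZero N] {x : ZMod N → ℂ} {M : ℝ}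
    (hM : ∀ t, ‖x t‖ ≤ M) (ω : ZMod N) :
    ‖ZMod.dft x ω‖ ≤ (Function.support x).ncard * M := by
  classical
  rw [ZMod.dft_apply, Set.ncard_eq_toFinset_card', ← nsmul_eq_mul,
    ← Finset.sum_subset (Finset.subset_univ (Function.support x).toFinset)]
  · refine (norm_sum_le _ _).trans (Finset.sum_le_card_nsmul _ _ _ fun t _ => ?_)
    rw [norm_smul, AddChar.norm_apply, one_mul]
    exact hM t
  · intro t _ ht
    have : x t = 0 := by simpa using ht
    rw [this, smul_zero]

/-- The multiplicative Donoho–Stark uncertainty principle on `ℤ/Nℤ`. -/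
theorem natCast_le_ncard_support_mul_ncard_support_zmod_dft {N : ℕ} [NeZero N]
    {x : ZMod N → ℂ} (hx : x ≠ 0) :
    (N : ℝ) ≤ (Function.support x).ncard * (Function.support (ZMod.dft x)).ncard := by
  obtain ⟨s, hs⟩ := Finite.exists_max fun t => ‖x t‖
  obtain ⟨r, hr⟩ := Function.ne_iff.mp hx
  have hpos : 0 < ‖x s‖ := (norm_pos_iff.mpr hr).trans_le (hs r)
  have h := norm_zmod_dft_le_ncard_support_mul
    (norm_zmod_dft_le_ncard_support_mul hs) (-s)
  rw [ZMod.dft_dft] at h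
  beta_reduce at h
  rw [neg_neg, norm_smul, Complex.norm_natCast, ← mul_assoc] at h
  exact (le_of_mul_le_mul_right h hpos).trans_eq (mul_comm _ _)

/-- If `x : ℤ/Nℤ → ℂ` is not identically zero, then `‖x‖₀ + ‖x̂‖₀ ≥ 2√N`. -/
theorem stmt_2 (N : ℕ) [NeZero N] (hN : 1 ≤ N) (x : ZMod N → ℂ) (hx : x ≠ 0) :
    2 * Real.sqrt N ≤
      ((Function.support x).ncard : ℝ) + ((Function.support (dft x)).ncard : ℝ) := by
  rw [dft_eq_zmod_dft]
  have h := natCast_le_ncard_support_mul_ncard_support_zmod_dft hx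
  refine (sq_le_sq₀ (by positivity) (by positivity)).mp ?_
  rw [mul_pow, Real.sq_sqrt (Nat.cast_nonneg N)]
  nlinarith [sq_nonneg (((Function.support x).ncard : ℝ) - (Function.support (ZMod.dft x)).ncard)]
end

section
/- Let N ≥ 2, let T ≥ 1 be an integer, let Ω ⊆ ℤ/Nℤ, and let K(t) = ∑_{ω∈Ω} e^{2πiωt/N} be the associated idempotent kernel, so K(0) = |Ω|. Assume |K(t)| < K(0)/(2T) for every t ∈ ℤ/Nℤ with t ≠ 0. Then every signal x : ℤ/Nℤ → ℂ supported on at most T points is the unique ℓ¹-minimal extension of its Fourier data on Ω: for every y : ℤ/Nℤ → ℂ with y ≠ x such that ŷ(ω) = x̂(ω) for all ω ∈ Ω, one has ∑_{t∈ℤ/Nℤ}|y(t)| > ∑_{t∈ℤ/Nℤ}|x(t)|. -/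
open Finset in
/-- A vector each of whose entries is dominated by the `ℓ¹` norm divided by `2T + 1` carries less
than half of its `ℓ¹` norm on any set of at most `T` points. -/
theorem two_mul_sum_lt_of_forall_mul_le {ι : Type*} [Fintype ι] {f : ι → ℝ} {T : ℕ}
    (hf : 0 < ∑ i, f i) (h : ∀ i, (2 * T + 1) * f i ≤ ∑ j, f j)
    {S : Finset ι} (hS : #S ≤ T) : 2 * ∑ i ∈ S, f i < ∑ i, f i := by
  have h1 : (2 * T + 1) * ∑ i ∈ S, f i ≤ #S * ∑ i, f i := by
    rw [mul_sum, ← nsmul_eq_mul]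
    exact sum_le_card_nsmul _ _ _ fun i _ ↦ h i
  have h2 : (#S : ℝ) * ∑ i, f i ≤ T * ∑ i, f i := by gcongr
  have hT : (0 : ℝ) < 2 * T + 1 := by positivity
  nlinarith

open Finset in
/-- The null space property: a perturbation carrying less than half of its `ℓ¹` norm on a set
containing the support of `x` increases the `ℓ¹` norm. -/
theorem sum_norm_lt_of_two_mul_sum_norm_sub_lt {ι E : Type*} [Fintype ι] [DecidableEq ι]
    [SeminormedAddCommGroup E] {x y : ι → E} {S : Finset ι} (hxS : ∀ i ∉ S, x i = 0)
    (h : 2 * ∑ i ∈ S, ‖y i - x i‖ < ∑ i, ‖y i - x i‖) : ∑ i, ‖x i‖ < ∑ i, ‖y i‖ := by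
  have key : ∑ i, (‖x i‖ + ‖y i - x i‖ - 2 * if i ∈ S then ‖y i - x i‖ else 0) ≤ ∑ i, ‖y i‖ := by
    refine sum_le_sum fun i _ ↦ ?_
    split_ifs with hi
    · have := norm_sub_norm_le (x i) (y i)
      rw [norm_sub_rev] at this
      linarith
    · simp [hxS i hi]
  rw [sum_sub_distrib, sum_add_distrib, ← mul_sum, sum_ite_mem, univ_inter] at key
  linarith

theorem ZMod.stdAddChar_mul_eq_exp {N : ℕ} [NeZero N] (a b : ZMod N) :
    ZMod.stdAddChar (a * b) = Complex.exp (2 * Real.pi * Complex.I * (a.val * b.val) / N) := by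
  have h := ZMod.stdAddChar_coe (N := N) (a.val * b.val : ℤ)
  push_cast at h
  simpa only [ZMod.natCast_zmod_val] using h

theorem dft_eq_sum_stdAddChar {N : ℕ} [NeZero N] (x : ZMod N → ℂ) (ω : ZMod N) :
    dft x ω = ∑ t, x t * ZMod.stdAddChar (-(ω * t)) := by
  refine Finset.sum_congr rfl fun t _ ↦ ?_
  rw [AddChar.map_neg_eq_inv, ZMod.stdAddChar_mul_eq_exp, ← Complex.exp_neg, neg_div]

theorem dft_sub {N : ℕ} [NeZero N] (x y : ZMod N → ℂ) (ω : ZMod N) :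
    dft (x - y) ω = dft x ω - dft y ω := by
  simp [dft, sub_mul]

/-- A signal whose Fourier transform vanishes on `Ω` is annihilated by convolution with the
idempotent kernel of `Ω`. -/
theorem sum_mul_kernel_eq_zero {N : ℕ} [NeZero N] {h : ZMod N → ℂ} {Ω : Finset (ZMod N)}
    (hh : ∀ ω ∈ Ω, dft h ω = 0) (s : ZMod N) :
    ∑ t, h t * ∑ ω ∈ Ω, ZMod.stdAddChar (ω * (s - t)) = 0 := by
  simp_rw [Finset.mul_sum]
  rw [Finset.sum_comm]
  refine Finset.sum_eq_zero fun ω hω ↦ ?_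
  have : ∑ t, h t * ZMod.stdAddChar (ω * (s - t)) = ZMod.stdAddChar (ω * s) * dft h ω := by
    rw [dft_eq_sum_stdAddChar, Finset.mul_sum]
    refine Finset.sum_congr rfl fun t _ ↦ ?_
    rw [mul_sub, sub_eq_add_neg, AddChar.map_add_eq_mul]
    ring
  rw [this, hh ω hω, mul_zero]

/-- If the idempotent kernel of `Ω` is at most `c` away from the origin, then every signal whose
Fourier transform vanishes on `Ω` is spread out. -/
theorem card_mul_norm_le_of_dft_eq_zero {N : ℕ} [NeZero N] {h : ZMod N → ℂ}
    {Ω : Finset (ZMod N)} {c : ℝ}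
    (hK : ∀ t : ZMod N, t ≠ 0 → ‖∑ ω ∈ Ω, ZMod.stdAddChar (ω * t)‖ ≤ c)
    (hh : ∀ ω ∈ Ω, dft h ω = 0) (s : ZMod N) :
    Ω.card * ‖h s‖ ≤ c * (∑ t, ‖h t‖ - ‖h s‖) := by
  have h0 := sum_mul_kernel_eq_zero hh s
  rw [← Finset.add_sum_erase _ _ (Finset.mem_univ s)] at h0
  simp only [sub_self, mul_zero, AddChar.map_zero_eq_one, Finset.sum_const, nsmul_eq_mul,
    mul_one] at h0
  rw [← Finset.sum_erase_eq_sub (Finset.mem_univ s), Finset.mul_sum]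
  calc Ω.card * ‖h s‖ = ‖h s * Ω.card‖ := by rw [norm_mul, Complex.norm_natCast, mul_comm]
    _ = ‖∑ t ∈ Finset.univ.erase s, h t * ∑ ω ∈ Ω, ZMod.stdAddChar (ω * (s - t))‖ := by
      rw [eq_neg_of_add_eq_zero_left h0, norm_neg]
    _ ≤ ∑ t ∈ Finset.univ.erase s, c * ‖h t‖ := by
      refine norm_sum_le_of_le _ fun t ht ↦ ?_
      rw [norm_mul, mul_comm]
      gcongr
      exact hK _ (sub_ne_zero.2 (Finset.ne_of_mem_erase ht).symm)

/-- Deterministic variant of the Candès–Romberg–Tao theorem: if the idempotent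
kernel `K(t) = ∑_{ω∈Ω} e^{2πiωt/N}` satisfies `|K(t)| < K(0)/(2T)` for all `t ≠ 0`,
then every signal supported on at most `T` points is the unique `ℓ¹`-minimal
extension of its Fourier data on `Ω`. -/
theorem stmt_13 (N : ℕ) [NeZero N] (hN : 2 ≤ N) (T : ℕ) (hT : 1 ≤ T)
    (Ω : Finset (ZMod N))
    (hK : ∀ t : ZMod N, t ≠ 0 →
      ‖∑ ω ∈ Ω, Complex.exp (2 * Real.pi * Complex.I * (ω.val * t.val) / N)‖ <
        (Ω.card : ℝ) / (2 * T))
    (x : ZMod N → ℂ) (hx : (Function.support x).ncard ≤ T)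
    (y : ZMod N → ℂ) (hyx : y ≠ x) (hagree : ∀ ω ∈ Ω, dft y ω = dft x ω) :
    (∑ t : ZMod N, ‖x t‖) < ∑ t : ZMod N, ‖y t‖ := by
  have hT0 : (0 : ℝ) < T := by exact_mod_cast hT
  simp_rw [← ZMod.stdAddChar_mul_eq_exp] at hK
  have : Fact (1 < N) := ⟨hN⟩
  have hΩ : (0 : ℝ) < Ω.card := by
    have := (norm_nonneg _).trans_lt (hK 1 one_ne_zero)
    rwa [lt_div_iff₀ (by positivity), zero_mul] at this
  have hh : ∀ ω ∈ Ω, dft (y - x) ω = 0 := fun ω hω ↦ by rw [dft_sub, hagree ω hω, sub_self]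
  have hspread (s : ZMod N) : (2 * T + 1) * ‖y s - x s‖ ≤ ∑ t, ‖y t - x t‖ := by
    have := card_mul_norm_le_of_dft_eq_zero (fun t ht ↦ (hK t ht).le) hh s
    rw [div_mul_eq_mul_div, le_div_iff₀ (by positivity), mul_assoc,
      mul_le_mul_iff_right₀ hΩ] at this
    simp only [Pi.sub_apply] at this
    linarith
  have hpos : 0 < ∑ t, ‖y t - x t‖ := by
    obtain ⟨s, hs⟩ := Function.ne_iff.1 hyx
    exact Finset.sum_pos' (fun _ _ ↦ norm_nonneg _)
      ⟨s, Finset.mem_univ s, norm_pos_iff.2 (sub_ne_zero.2 hs)⟩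
  have hfin := Set.toFinite (Function.support x)
  refine sum_norm_lt_of_two_mul_sum_norm_sub_lt (S := hfin.toFinset) (by simp) ?_
  exact two_mul_sum_lt_of_forall_mul_le hpos hspread
    (by rwa [← Set.ncard_eq_toFinset_card _ hfin])
end
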